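/- arXiv:0906.3815 — 2 statements merged into one kernel-verified Lean document; each statement's English description precedes it below -/
import Mathlib

section
/- For any normal logic program P, the operator Ψ_P on 3-valued Herbrand interpretations is monotonic: if I ⊆ J then Ψ_P(I) ⊆ Ψ_P(J). -/
/- Formalization of the framework of "Hybrid Rules with Well-Founded Semantics"
   (Drabent, Małuszyński). -/

namespace HybridRules

/-- Variables. -/
abbrev Var := ℕ

/-- First-order terms over an alphabet `Func` of function symbols
(constants being function symbols of arity 0). -/
inductive Tm (Func : Type) : Type
  | var : Var → Tm Func
  | app : Func → List (Tm Func) → Tm Func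

namespace Tm

variable {Func : Type}

/-- Applying a substitution to a term. -/
def subst (θ : Var → Tm Func) : Tm Func → Tm Func
  | var v => θ v
  | app f ts => app f (ts.attach.map (fun t => subst θ t.1))
decreasing_by
  have := List.sizeOf_lt_of_mem t.2
  simp only [Tm.app.sizeOf_spec]
  omega

/-- The list of variable occurrences of a term. -/
def varsList : Tm Func → List Var
  | var v => [v]
  | app _ ts => (ts.attach.map (fun t => varsList t.1)).flatten
decreasing_by
  have := List.sizeOf_lt_of_mem t.2
  simp only [Tm.app.sizeOf_spec]
  omega

/-- The number of occurrences of the variable `x` in a term. -/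
def count (x : Var) : Tm Func → ℕ
  | var v => if v = x then 1 else 0
  | app _ ts => (ts.attach.map (fun t => count x t.1)).sum
decreasing_by
  have := List.sizeOf_lt_of_mem t.2
  simp only [Tm.app.sizeOf_spec]
  omega

/-- The set of variables of a term. -/
def vars (t : Tm Func) : Set Var := {v | v ∈ t.varsList}

/-- A term is ground if it contains no variables. -/
def Ground (t : Tm Func) : Prop := t.varsList = []

end Tm

variable {RP Func : Type}

/-- An atom `p(t₁,…,tₙ)` built from a (rule) predicate symbol and a list of terms. -/
structure Atom (RP Func : Type) where
  pred : RP
  args : List (Tm Func)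

namespace Atom

/-- Applying a substitution to an atom. -/
def subst (θ : Var → Tm Func) (a : Atom RP Func) : Atom RP Func :=
  ⟨a.pred, a.args.map (Tm.subst θ)⟩

/-- The set of variables of an atom. -/
def vars (a : Atom RP Func) : Set Var := {v | ∃ t ∈ a.args, v ∈ t.vars}

/-- A ground atom. -/
def Ground (a : Atom RP Func) : Prop := ∀ t ∈ a.args, t.Ground

/-- The number of occurrences of the variable `x` in an atom. -/
def count (x : Var) (a : Atom RP Func) : ℕ := (a.args.map (Tm.count x)).sum

end Atom

/-- A literal: `(true, A)` is the positive literal `A`,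
`(false, A)` is the negative literal `¬A`.  (Elements `(b,A)` with `A` a
ground atom also serve as the elements of `H ∪ ¬H`, where negated predicates
are treated as fresh predicates.) -/
abbrev Lit (RP Func : Type) := Bool × Atom RP Func

/-- Applying a substitution to a literal. -/
def Lit.subst (θ : Var → Tm Func) (l : Lit RP Func) : Lit RP Func := (l.1, l.2.subst θ)

/-- A ground literal. -/
def Lit.Ground (l : Lit RP Func) : Prop := l.2.Ground

/-- The negation of a literal. -/
def Lit.negate (l : Lit RP Func) : Lit RP Func := (!l.1, l.2)

/-- A rule (normal clause) `H ← B₁,…,Bₙ` of a normal logic program. -/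
structure NRule (RP Func : Type) where
  head : Atom RP Func
  body : List (Lit RP Func)

/-- A normal logic program: a finite set of rules. -/
structure NProgram (RP Func : Type) where
  rules : Set (NRule RP Func)
  finite : rules.Finite

/-- A rule of a (ground) definite program over `H ∪ ¬H`: the head is a
(possibly negative) literal, treating `¬p` as a fresh predicate. -/
structure GRule (RP Func : Type) where
  head : Lit RP Func
  body : List (Lit RP Func)

/-- A ground rule. -/
def GRule.Ground (r : GRule RP Func) : Prop :=
  Lit.Ground r.head ∧ ∀ b ∈ r.body, Lit.Ground b

/-- `ground(P)`: the set of ground instances of the rules of a normal program,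
viewed as rules over `H ∪ ¬H`. -/
def groundOf (P : NProgram RP Func) : Set (GRule RP Func) :=
  {r | ∃ R ∈ P.rules, ∃ θ : Var → Tm Func,
        r.head = (true, R.head.subst θ) ∧ r.body = R.body.map (Lit.subst θ) ∧ r.Ground}

/-- The Herbrand base: the set of ground atoms. -/
def HB : Set (Atom RP Func) := {a | a.Ground}

/-- A 3-valued Herbrand interpretation, as a subset of `H ∪ ¬H`
(signed ground atoms). -/
abbrev Interp (RP Func : Type) := Set (Lit RP Func)

/-- `I` is a 3-valued Herbrand interpretation: a set of signed ground atoms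
containing no atom together with its negation. -/
def ConsistentInterp (I : Interp RP Func) : Prop :=
  (∀ l ∈ I, Lit.Ground l) ∧ ∀ a : Atom RP Func, ¬ ((true, a) ∈ I ∧ (false, a) ∈ I)

/-- `M` is a (2-valued) model of the definite program `Q` over `H ∪ ¬H`. -/
def IsModelOf (Q : Set (GRule RP Func)) (M : Set (Lit RP Func)) : Prop :=
  ∀ r ∈ Q, (∀ b ∈ r.body, b ∈ M) → r.head ∈ M

/-- `M_Q`: the least (2-valued) Herbrand model of a definite program `Q`. -/
def leastModel (Q : Set (GRule RP Func)) : Set (Lit RP Func) :=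
  ⋂₀ {M | IsModelOf Q M}

/-- `Q/t I  =  Q ∪ { ¬A | ¬A ∈ I }`. -/
def progT (Q : Set (GRule RP Func)) (I : Interp RP Func) : Set (GRule RP Func) :=
  Q ∪ {r | ∃ a, (false, a) ∈ I ∧ r = ⟨(false, a), []⟩}

/-- `Q/tu I  =  Q ∪ { ¬A | A ∉ I, A ∈ H }`. -/
def progTU (Q : Set (GRule RP Func)) (I : Interp RP Func) : Set (GRule RP Func) :=
  Q ∪ {r | ∃ a, a ∈ HB ∧ (true, a) ∉ I ∧ r = ⟨(false, a), []⟩}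

/-- The operator `Ψ_Q(I) = (M_{Q/t I} ∩ H) ∪ ¬(H \ M_{Q/tu I})` on 3-valued
Herbrand interpretations, for a set `Q` of ground rules. -/
def psi (Q : Set (GRule RP Func)) (I : Interp RP Func) : Interp RP Func :=
  {l | l.1 = true ∧ l.2 ∈ HB ∧ l ∈ leastModel (progT Q I)} ∪
  {l | l.1 = false ∧ l.2 ∈ HB ∧ (true, l.2) ∉ leastModel (progTU Q I)}

/-- Transfinite iteration of `Ψ_Q`:
`Ψ↑0 = ∅`, `Ψ↑(β+1) = Ψ(Ψ↑β)`, and `Ψ↑λ = ⋃_{β<λ} Ψ↑β` at limits. -/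
noncomputable def psiIter (Q : Set (GRule RP Func)) (o : Ordinal) : Interp RP Func :=
  Ordinal.limitRecOn o ∅ (fun _ ih => psi Q ih)
    (fun o' _ ih => {l | ∃ o'', ∃ h : o'' < o', l ∈ ih o'' h})

end HybridRules

namespace HybridRules

/-- For any normal logic program `P`, the operator `Ψ_P` on
3-valued Herbrand interpretations is monotonic: if `I ⊆ J` then
`Ψ_P(I) ⊆ Ψ_P(J)`. -/
theorem psi_monotone {RP Func : Type} (P : NProgram RP Func)
    (I J : Interp RP Func) (hI : ConsistentInterp I) (hJ : ConsistentInterp J)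
    (hIJ : I ⊆ J) :
    psi (groundOf P) I ⊆ psi (groundOf P) J := by
  have mono : ∀ {Q R : Set (GRule RP Func)}, Q ⊆ R → leastModel Q ⊆ leastModel R := by
    intro Q R h l hl M hM
    exact hl M (fun r hr => hM r (h hr))
  rintro l (⟨h1, h2, h3⟩ | ⟨h1, h2, h3⟩)
  · refine Or.inl ⟨h1, h2, mono ?_ h3⟩
    rintro r (hr | ⟨a, ha, hr⟩)
    · exact Or.inl hr
    · exact Or.inr ⟨a, hIJ ha, hr⟩
  · refine Or.inr ⟨h1, h2, fun h => h3 (mono ?_ h)⟩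
    rintro r (hr | ⟨a, ha, hn, hr⟩)
    · exact Or.inl hr
    · exact Or.inr ⟨a, ha, fun h => hn (hIJ h), hr⟩


end HybridRules
end

section
/- For any normal logic program P, the monotonic operator Ψ_P has a least fixed point WF(P) (the well-founded model of P), and WF(P) = Ψ_P↑α for some countable ordinal α, where Ψ_P↑0 = ∅, Ψ_P↑(β+1) = Ψ_P(Ψ_P↑β), and Ψ_P↑λ = ⋃_{β<λ} Ψ_P↑β for limit ordinals λ. -/
namespace HybridRules

section Aux

variable {RP Func : Type}

theorem leastModel_mono {Q Q' : Set (GRule RP Func)} (h : Q ⊆ Q') :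
    leastModel Q ⊆ leastModel Q' := by
  intro l hl M hM
  exact hl M (fun r hr => hM r (h hr))

theorem progT_mono (Q : Set (GRule RP Func)) {I J : Interp RP Func} (h : I ⊆ J) :
    progT Q I ⊆ progT Q J := by
  rintro r (hr | ⟨a, ha, rfl⟩)
  · exact Or.inl hr
  · exact Or.inr ⟨a, h ha, rfl⟩

theorem progTU_anti (Q : Set (GRule RP Func)) {I J : Interp RP Func} (h : I ⊆ J) :
    progTU Q J ⊆ progTU Q I := by
  rintro r (hr | ⟨a, ha, hn, rfl⟩)
  · exact Or.inl hr
  · exact Or.inr ⟨a, ha, fun hi => hn (h hi), rfl⟩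

theorem psi_mono (Q : Set (GRule RP Func)) {I J : Interp RP Func} (h : I ⊆ J) :
    psi Q I ⊆ psi Q J := by
  rintro l (⟨h1, h2, h3⟩ | ⟨h1, h2, h3⟩)
  · exact Or.inl ⟨h1, h2, leastModel_mono (progT_mono Q h) h3⟩
  · exact Or.inr ⟨h1, h2, fun hi => h3 (leastModel_mono (progTU_anti Q h) hi)⟩

theorem psiIter_zero (Q : Set (GRule RP Func)) : psiIter Q 0 = ∅ := by
  simp [psiIter]

theorem psiIter_add_one (Q : Set (GRule RP Func)) (o : Ordinal) :
    psiIter Q (o + 1) = psi Q (psiIter Q o) := by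
  simp [psiIter]

theorem psiIter_limit (Q : Set (GRule RP Func)) (o : Ordinal) (ho : Order.IsSuccLimit o) :
    psiIter Q o = {l | ∃ o', ∃ _ : o' < o, l ∈ psiIter Q o'} := by
  unfold psiIter
  rw [Ordinal.limitRecOn_limit _ _ _ _ ho]

theorem psiIter_subset_psi (Q : Set (GRule RP Func)) (o : Ordinal) :
    psiIter Q o ⊆ psi Q (psiIter Q o) := by
  induction o using Ordinal.limitRecOn with
  | zero => simp [psiIter_zero]
  | add_one o ih => rw [psiIter_add_one]; exact psi_mono Q ih
  | limit o ho ih =>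
    intro l hl
    have hl' := hl
    rw [psiIter_limit Q o ho] at hl'
    obtain ⟨o', h', hl'⟩ := hl'
    refine psi_mono Q ?_ (ih o' h' hl')
    intro x hx
    rw [psiIter_limit Q o ho]
    exact ⟨o', h', hx⟩

theorem psiIter_mono (Q : Set (GRule RP Func)) (a b : Ordinal) (hab : a ≤ b) :
    psiIter Q a ⊆ psiIter Q b := by
  induction b using Ordinal.limitRecOn with
  | zero => rw [nonpos_iff_eq_zero.1 hab]
  | add_one o ih =>
    rcases hab.eq_or_lt with h | h
    · rw [h]
    · rw [psiIter_add_one]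
      exact (ih (Order.lt_add_one_iff.1 h)).trans (psiIter_subset_psi Q o)
  | limit o ho ih =>
    rcases hab.eq_or_lt with h | h
    · rw [h]
    · intro x hx
      rw [psiIter_limit Q o ho]
      exact ⟨a, h, hx⟩

theorem psiIter_subset_fixed (Q : Set (GRule RP Func)) (I : Interp RP Func) (hI : psi Q I = I)
    (o : Ordinal) : psiIter Q o ⊆ I := by
  induction o using Ordinal.limitRecOn with
  | zero => simp [psiIter_zero]
  | add_one o ih =>
    rw [psiIter_add_one]
    exact (psi_mono Q ih).trans hI.subset
  | limit o ho ih =>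
    rw [psiIter_limit Q o ho]
    rintro l ⟨o', h', hl⟩
    exact ih o' h' hl

/-- Terms of bounded depth. -/
def tmLevel (Func : Type) : ℕ → Set (Tm Func)
  | 0 => ∅
  | n + 1 => Set.range Tm.var ∪
      Set.range (fun p : Func × List (tmLevel Func n) => Tm.app p.1 (p.2.map Subtype.val))

theorem tmLevel_countable [Countable Func] (n : ℕ) : (tmLevel Func n).Countable := by
  induction n with
  | zero => exact Set.countable_empty
  | succ n ih =>
    have : Countable (tmLevel Func n) := ih.to_subtype
    exact (Set.countable_range _).union (Set.countable_range _)

theorem mem_tmLevel (n : ℕ) : ∀ t : Tm Func, sizeOf t ≤ n → t ∈ tmLevel Func n := by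
  induction n with
  | zero =>
    intro t ht
    cases t <;> simp at ht
  | succ n ih =>
    intro t ht
    cases t with
    | var v => exact Or.inl ⟨v, rfl⟩
    | app f ts =>
      refine Or.inr ⟨(f, ts.attach.map (fun t => ⟨t.1, ih t.1 ?_⟩)), ?_⟩
      · have := List.sizeOf_lt_of_mem t.2
        simp only [Tm.app.sizeOf_spec] at ht
        omega
      · simp [Function.comp_def]

theorem tm_countable [Countable Func] : Countable (Tm Func) := by
  rw [← Set.countable_univ_iff]
  refine (Set.countable_iUnion (fun n => tmLevel_countable (Func := Func) n)).mono ?_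
  intro t _
  exact Set.mem_iUnion.2 ⟨sizeOf t, mem_tmLevel _ t le_rfl⟩

theorem lit_countable [Countable RP] [Countable Func] : Countable (Lit RP Func) := by
  have := tm_countable (Func := Func)
  have : Countable (Atom RP Func) := by
    refine Function.Injective.countable (f := fun a : Atom RP Func => (a.pred, a.args)) ?_
    rintro ⟨p, a⟩ ⟨q, b⟩ h
    simpa using h
  infer_instance

theorem exists_stage [Countable RP] [Countable Func] (Q : Set (GRule RP Func)) :
    ∃ α : Ordinal, α.card ≤ Cardinal.aleph0 ∧ psi Q (psiIter Q α) = psiIter Q α := by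
  by_contra! hne
  have hlt : ∀ α : Set.Iio (Cardinal.aleph 1).ord,
      ∃ l, l ∈ psiIter Q (α.1 + 1) ∧ l ∉ psiIter Q α.1 := by
    rintro ⟨α, hα⟩
    have hc : α.card ≤ Cardinal.aleph0 := by
      have h := Cardinal.lt_ord.1 hα
      rw [← Cardinal.succ_aleph0] at h
      exact Order.lt_succ_iff.1 h
    by_contra! h
    refine hne α hc (Set.Subset.antisymm ?_ (psiIter_subset_psi Q α))
    rw [← psiIter_add_one]
    exact h
  choose f hf1 hf2 using hlt
  have hinj : Function.Injective f := by
    have key : ∀ a b : Set.Iio (Cardinal.aleph 1).ord, a < b → f a ≠ f b := by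
      intro a b hab he
      refine hf2 b (he ▸ psiIter_mono Q _ _ ?_ (hf1 a))
      exact Order.add_one_le_of_lt hab
    intro a b he
    rcases lt_trichotomy a b with h | h | h
    · exact (key a b h he).elim
    · exact h
    · exact (key b a h he.symm).elim
  have := lit_countable (RP := RP) (Func := Func)
  have hcount := hinj.countable
  rw [← Cardinal.mk_le_aleph0_iff, Cardinal.mk_Iio_ordinal, Cardinal.card_ord,
    Cardinal.lift_le_aleph0] at hcount
  exact absurd hcount (not_le.2 Cardinal.aleph0_lt_aleph_one)

end Aux

/-- For any normal logic program `P`, the monotonic operator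
`Ψ_P` has a least fixed point `WF(P)` (the well-founded model of `P`), and
`WF(P) = Ψ_P↑α` for some countable ordinal `α`. -/
theorem wf_model_exists {RP Func : Type} [Countable RP] [Countable Func]
    (P : NProgram RP Func) :
    ∃ W : Interp RP Func,
      psi (groundOf P) W = W ∧
      (∀ I : Interp RP Func, psi (groundOf P) I = I → W ⊆ I) ∧
      ∃ α : Ordinal, α.card ≤ Cardinal.aleph0 ∧ W = psiIter (groundOf P) α := by
  obtain ⟨α, hα, hfix⟩ := exists_stage (groundOf P)
  exact ⟨psiIter (groundOf P) α, hfix,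
    fun I hI => psiIter_subset_fixed _ I hI α, α, hα, rfl⟩

end HybridRules
end
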